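/- (Theorem 1, distilled.) Let N be a contact-free (1-safe) Petri net with place out-degree at most one, i.e. a net of the kind induced by an environment strategy, where every conflict has been resolved. Then the firing behavior of N is unique up to reordering of independent transitions: any two finite firing sequences from Init that both end in a deadlocked marking (a marking at which no transition is enabled) have the same length, fire the same multiset of transitions, and reach the same final marking. -/

import Mathlib

/-- A (1-bounded) Petri net with places `P` and transitions `T`. -/
structure PetriNet (P T : Type*) where
  pre : T → Set P
  post : T → Set P
  pre_fin : ∀ t, (pre t).Finite
  pre_ne : ∀ t, (pre t).Nonempty
  post_fin : ∀ t, (post t).Finite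
  post_ne : ∀ t, (post t).Nonempty
  Init : Set P

namespace PetriNet

variable {P T : Type*} (N : PetriNet P T)

/-- A transition `t` is enabled at marking `M` if its preset is contained in `M`. -/
def Enabled (M : Set P) (t : T) : Prop := N.pre t ⊆ M

/-- Firing transition `t` at marking `M` yields `(M \ pre t) ∪ post t`. -/
def fire (M : Set P) (t : T) : Set P := (M \ N.pre t) ∪ N.post t

/-- The firing of `t` at `M` is contact-free if `post t ∩ (M \ pre t) = ∅`. -/
def ContactFreeAt (M : Set P) (t : T) : Prop := N.post t ∩ (M \ N.pre t) = ∅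

/-- `FiresTo N M l M'` : the firing sequence `l` can be fired successively from `M`,
reaching `M'`. -/
inductive FiresTo : Set P → List T → Set P → Prop
  | nil (M : Set P) : FiresTo M [] M
  | cons {M M' : Set P} {t : T} {l : List T} :
      N.Enabled M t → FiresTo (N.fire M t) l M' → FiresTo M (t :: l) M'

/-- The set of sequentially reachable markings. -/
def ReachSeq : Set (Set P) := {M | ∃ l : List T, N.FiresTo N.Init l M}

/-- The net is contact-free (1-safe): every firing of an enabled transition at a
sequentially reachable marking is contact-free. -/
def ContactFreeNet : Prop :=
  ∀ M ∈ N.ReachSeq, ∀ t : T, N.Enabled M t → N.ContactFreeAt M t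

/-- `U` is a nonempty finite set of transitions that are all enabled at `M`
and have pairwise disjoint presets. -/
def ConcEnabled (M : Set P) (U : Set T) : Prop :=
  U.Nonempty ∧ U.Finite ∧ (∀ t ∈ U, N.Enabled M t) ∧
    (∀ t1 ∈ U, ∀ t2 ∈ U, t1 ≠ t2 → N.pre t1 ∩ N.pre t2 = ∅)

/-- The result of the concurrent step firing the set `U` at `M`. -/
def concFire (M : Set P) (U : Set T) : Set P :=
  (M \ ⋃ t ∈ U, N.pre t) ∪ ⋃ t ∈ U, N.post t

/-- A maximal concurrent step: `U` is maximal among nonempty sets of transitions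
enabled at `M` with pairwise disjoint presets, and firing `U` at `M` yields `M'`. -/
def MaxConcStep (M : Set P) (U : Set T) (M' : Set P) : Prop :=
  N.ConcEnabled M U ∧ (∀ V : Set T, N.ConcEnabled M V → U ⊆ V → V = U) ∧
    M' = N.concFire M U

/-- Reachability by a sequence of maximal concurrent steps
(true concurrent flow semantics). -/
inductive TCFiresTo : Set P → Set P → Prop
  | refl (M : Set P) : TCFiresTo M M
  | step {M M' M'' : Set P} (U : Set T) :
      N.MaxConcStep M U M' → TCFiresTo M' M'' → TCFiresTo M M''

/-- The set of markings reachable under the true concurrent flow semantics. -/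
def ReachTC : Set (Set P) := {M | N.TCFiresTo N.Init M}

/-- The net has place out-degree at most one: each place has at most one
outgoing transition. -/
def OutDegOne : Prop := ∀ p : P, ∀ t1 t2 : T, p ∈ N.pre t1 → p ∈ N.pre t2 → t1 = t2

end PetriNet

namespace PetriNet

variable {P T : Type*} {N : PetriNet P T}

theorem FiresTo.append_fire {M M' : Set P} {l : List T} {t : T} (h : N.FiresTo M l M')
    (ht : N.Enabled M' t) : N.FiresTo M (l ++ [t]) (N.fire M' t) := by
  induction h with
  | nil M => exact .cons ht (.nil _)
  | cons hu _ ih => exact .cons hu (ih ht)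

theorem fire_mem_reachSeq {M : Set P} {t : T} (hM : M ∈ N.ReachSeq) (ht : N.Enabled M t) :
    N.fire M t ∈ N.ReachSeq := by
  obtain ⟨l, hl⟩ := hM
  exact ⟨l ++ [t], hl.append_fire ht⟩

theorem OutDegOne.disjoint_pre (hdeg : N.OutDegOne) {t u : T} (htu : t ≠ u) :
    Disjoint (N.pre t) (N.pre u) :=
  Set.disjoint_left.2 fun p hp hq => htu (hdeg p t u hp hq)

/-- An enabled transition stays enabled when one with a disjoint preset fires. -/
theorem Enabled.fire_of_disjoint {M : Set P} {t u : T} (hu : N.Enabled M u)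
    (hd : Disjoint (N.pre t) (N.pre u)) : N.Enabled (N.fire M t) u :=
  (Set.subset_sdiff.2 ⟨hu, hd.symm⟩).trans Set.subset_union_left

/-- A contact-free firing produces no token in the preset of an enabled transition
whose preset is disjoint from that of the fired one. -/
theorem ContactFreeAt.disjoint_post_pre {M : Set P} {t u : T} (hc : N.ContactFreeAt M t)
    (hu : N.Enabled M u) (hd : Disjoint (N.pre t) (N.pre u)) :
    Disjoint (N.post t) (N.pre u) :=
  (Set.disjoint_iff_inter_eq_empty.2 hc).mono_right
    (Set.subset_sdiff.2 ⟨hu, hd.symm⟩)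

theorem fire_comm {M : Set P} {t u : T} (htu : Disjoint (N.post t) (N.pre u))
    (hut : Disjoint (N.post u) (N.pre t)) :
    N.fire (N.fire M t) u = N.fire (N.fire M u) t := by
  simp only [fire, Set.union_sdiff_distrib, htu.sdiff_eq_left, hut.sdiff_eq_left,
    Set.sdiff_sdiff, Set.union_comm (N.pre t), Set.union_assoc, Set.union_comm (N.post t)]

/-- An enabled transition can be moved to the front of any run to a deadlock. -/
theorem FiresTo.exists_perm_cons (hcf : N.ContactFreeNet) (hdeg : N.OutDegOne)
    {M M' : Set P} {l : List T} (h : N.FiresTo M l M') (hM : M ∈ N.ReachSeq)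
    (hdl : ∀ t, ¬ N.Enabled M' t) {t : T} (ht : N.Enabled M t) :
    ∃ l', l.Perm (t :: l') ∧ N.FiresTo (N.fire M t) l' M' := by
  induction h with
  | nil M => exact absurd ht (hdl t)
  | @cons M M' u l hu hl ih =>
    by_cases htu : t = u
    · subst htu
      exact ⟨l, .refl _, hl⟩
    · have hd := hdeg.disjoint_pre htu
      obtain ⟨l', hp, hl'⟩ := ih (fire_mem_reachSeq hM hu) hdl (ht.fire_of_disjoint hd.symm)
      refine ⟨u :: l', (hp.cons u).trans (.swap t u l'), .cons (hu.fire_of_disjoint hd) ?_⟩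
      rwa [fire_comm ((hcf M hM t ht).disjoint_post_pre hu hd)
        ((hcf M hM u hu).disjoint_post_pre ht hd.symm)]

/-- Any two runs from a reachable marking to deadlocks are permutations of each other
and end in the same marking. -/
theorem FiresTo.perm_and_eq_of_deadlock (hcf : N.ContactFreeNet) (hdeg : N.OutDegOne)
    {M M₁ M₂ : Set P} {l₁ l₂ : List T} (h₁ : N.FiresTo M l₁ M₁) (h₂ : N.FiresTo M l₂ M₂)
    (hM : M ∈ N.ReachSeq) (hdl₁ : ∀ t, ¬ N.Enabled M₁ t) (hdl₂ : ∀ t, ¬ N.Enabled M₂ t) :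
    l₁.Perm l₂ ∧ M₁ = M₂ := by
  induction h₁ generalizing l₂ with
  | nil M =>
    cases h₂ with
    | nil => exact ⟨.refl _, rfl⟩
    | cons ht _ => exact absurd ht (hdl₁ _)
  | @cons M M' t l ht _ ih =>
    obtain ⟨l', hp, hl'⟩ := h₂.exists_perm_cons hcf hdeg hM hdl₂ ht
    obtain ⟨hperm, heq⟩ := ih hl' (fire_mem_reachSeq hM ht) hdl₁
    exact ⟨(hperm.cons t).trans hp.symm, heq⟩

end PetriNet

/-- Theorem 1, distilled: in a contact-free net with place
out-degree at most one, any two firing sequences from `Init` ending in deadlocked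
markings have the same length, fire the same multiset of transitions, and reach
the same final marking. -/
theorem unique_run_up_to_reordering {P T : Type*} (N : PetriNet P T)
    (hcf : N.ContactFreeNet) (hdeg : N.OutDegOne)
    (l1 l2 : List T) (M1 M2 : Set P)
    (h1 : N.FiresTo N.Init l1 M1) (h2 : N.FiresTo N.Init l2 M2)
    (hdl1 : ∀ t : T, ¬ N.Enabled M1 t) (hdl2 : ∀ t : T, ¬ N.Enabled M2 t) :
    l1.length = l2.length ∧ (l1 : Multiset T) = (l2 : Multiset T) ∧ M1 = M2 := by
  obtain ⟨hp, hM⟩ := h1.perm_and_eq_of_deadlock hcf hdeg h2 ⟨[], .nil _⟩ hdl1 hdl2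
  exact ⟨hp.length_eq, Multiset.coe_eq_coe.2 hp, hM⟩
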